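/- arXiv:2112.14323 — 7 statements merged into one kernel-verified Lean document; each statement's English description precedes it below -/
import Mathlib

section
/- Let L be a free ℤ-module of finite rank with a symmetric bilinear form B : L × L → ℤ, let ε : L × L → {±1} be a normalized 2-cocycle satisfying the skew condition for B, and let g be an isometry of (L, B). Then there exists a function u : L → {±1} such that ε(α,β)·u(α+β) = ε(gα, gβ)·u(α)·u(β) for all α, β ∈ L. -/
/-- The underlying set `A × L` of the extension of `L` by `A` defined by the 2-cocycle `c`. -/
@[ext]
structure CocycleExtension {L A : Type*} (c : L → L → A) where
  /-- The component in the kernel of the extension. -/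
  coeff : A
  /-- The component in the quotient of the extension. -/
  base : L

namespace CocycleExtension

variable {L A : Type*} [AddCommGroup L] [CommGroup A] {c : L → L → A}

instance : Add (CocycleExtension c) :=
  ⟨fun x y => ⟨x.coeff * y.coeff * c x.base y.base, x.base + y.base⟩⟩

instance : Zero (CocycleExtension c) := ⟨⟨1, 0⟩⟩

instance : Neg (CocycleExtension c) :=
  ⟨fun x => ⟨x.coeff⁻¹ * (c (-x.base) x.base)⁻¹, -x.base⟩⟩

/-- The group law `(a, α) + (b, β) = (a * b * c α β, α + β)`; it is commutative because the
cocycle `c` is symmetric. -/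
@[reducible]
def addCommGroup (hcoc : ∀ α β γ : L, c α β * c (α + β) γ = c β γ * c α (β + γ))
    (hzero : ∀ α : L, c 0 α = 1) (hsymm : ∀ α β : L, c α β = c β α) :
    AddCommGroup (CocycleExtension c) where
  add_assoc x y z := by
    refine CocycleExtension.ext ?_ (add_assoc x.base y.base z.base)
    change x.coeff * y.coeff * c x.base y.base * z.coeff * c (x.base + y.base) z.base =
      x.coeff * (y.coeff * z.coeff * c y.base z.base) * c x.base (y.base + z.base)
    calc
      _ = x.coeff * y.coeff * z.coeff * (c x.base y.base * c (x.base + y.base) z.base) := by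
        ac_rfl
      _ = _ := by rw [hcoc]; ac_rfl
  zero_add x := by
    refine CocycleExtension.ext ?_ (zero_add x.base)
    change 1 * x.coeff * c 0 x.base = x.coeff
    rw [hzero, one_mul, mul_one]
  add_zero x := by
    refine CocycleExtension.ext ?_ (add_zero x.base)
    change x.coeff * 1 * c x.base 0 = x.coeff
    rw [hsymm, hzero, mul_one, mul_one]
  neg_add_cancel x := by
    refine CocycleExtension.ext ?_ (neg_add_cancel x.base)
    change x.coeff⁻¹ * (c (-x.base) x.base)⁻¹ * x.coeff * c (-x.base) x.base = 1
    rw [mul_right_comm x.coeff⁻¹, inv_mul_cancel, one_mul, inv_mul_cancel]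
  add_comm x y := by
    refine CocycleExtension.ext ?_ (add_comm x.base y.base)
    change x.coeff * y.coeff * c x.base y.base = y.coeff * x.coeff * c y.base x.base
    rw [hsymm, mul_comm x.coeff]
  nsmul := nsmulRec
  zsmul := zsmulRec

end CocycleExtension

/-- A normalized symmetric 2-cocycle on a free abelian group is a coboundary. -/
theorem exists_coboundary_of_symmetric_cocycle {L A : Type*} [AddCommGroup L] [Module.Free ℤ L]
    [CommGroup A] (c : L → L → A)
    (hcoc : ∀ α β γ : L, c α β * c (α + β) γ = c β γ * c α (β + γ))
    (hzero : ∀ α : L, c 0 α = 1) (hsymm : ∀ α β : L, c α β = c β α) :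
    ∃ u : L → A, ∀ α β : L, u (α + β) = u α * u β * c α β := by
  let _ := CocycleExtension.addCommGroup hcoc hzero hsymm
  let p : CocycleExtension c →+ L :=
    { toFun := CocycleExtension.base
      map_zero' := rfl
      map_add' := fun _ _ => rfl }
  obtain ⟨s, hs⟩ := Module.projective_lifting_property p.toIntLinearMap LinearMap.id
    (fun α => ⟨⟨1, α⟩, rfl⟩)
  have hbase (α : L) : (s α).base = α := LinearMap.congr_fun hs α
  refine ⟨fun α => (s α).coeff, fun α β => ?_⟩
  change (s (α + β)).coeff = _
  rw [map_add]
  change (s α).coeff * (s β).coeff * c (s α).base (s β).base = _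
  rw [hbase, hbase]

/-- **Existence of lifts of lattice isometries.**
Let `L` be a free `ℤ`-module of finite rank with a symmetric bilinear form `B`, let
`ε : L × L → {±1}` be a normalized 2-cocycle satisfying the skew condition for `B`, and let
`g` be an isometry of `(L, B)`.  Then there is a function `u : L → {±1}` such that
`ε(α,β)·u(α+β) = ε(gα, gβ)·u(α)·u(β)` for all `α, β ∈ L`. -/
theorem cocycle_lift_exists {L : Type*} [AddCommGroup L] [Module.Free ℤ L] [Module.Finite ℤ L]
    (B : L →ₗ[ℤ] L →ₗ[ℤ] ℤ) (hBsymm : ∀ α β : L, B α β = B β α)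
    (ε : L → L → ℤˣ)
    (hcoc : ∀ α β γ : L, ε α β * ε (α + β) γ = ε β γ * ε α (β + γ))
    (hnorm : ∀ α : L, ε α 0 = 1 ∧ ε 0 α = 1)
    (hskew : ∀ α β : L, ε α β = (-1 : ℤˣ) ^ (B α β) * ε β α)
    (g : L ≃ₗ[ℤ] L) (hg : ∀ α β : L, B (g α) (g β) = B α β) :
    ∃ u : L → ℤˣ, ∀ α β : L, ε α β * u (α + β) = ε (g α) (g β) * u α * u β := by
  obtain ⟨u, hu⟩ := exists_coboundary_of_symmetric_cocycle
    (fun α β => ε α β * ε (g α) (g β))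
    (fun α β γ => by
      simp only [map_add]
      rw [mul_mul_mul_comm, hcoc, hcoc, mul_mul_mul_comm])
    (fun α => by simp [hnorm])
    (fun α β => by
      rw [hskew α β, hskew (g α), hg, mul_mul_mul_comm, Int.units_mul_self, one_mul])
  refine ⟨u, fun α β => ?_⟩
  calc
    ε α β * u (α + β) = ε α β * ε α β * (ε (g α) (g β) * u α * u β) := by
      rw [hu]; ac_rfl
    _ = _ := by rw [Int.units_mul_self, one_mul]
end

section
/- Let L be a free ℤ-module of finite rank with a symmetric bilinear form B : L × L → ℤ that is even (B(α,α) ∈ 2ℤ for all α), let ε : L × L → {±1} be a normalized 2-cocycle satisfying the skew condition for B, and let g be an isometry of (L, B) of exact order m. Let u : L → {±1} satisfy u(0) = 1, ε(gα, gβ)·u(α)·u(β) = ε(α, β)·u(α+β) for all α, β ∈ L, and u(β) = 1 whenever gβ = β (a standard lift). Let ĝ be the automorphism of the double cover L̂ defined by ĝ(α, s) = (gα, u(α)·s). Then: if m is odd, ĝ has order m; if m is even, ĝ has order m when B(α, g^{m/2}α) ∈ 2ℤ for all α ∈ L, and order 2m otherwise. -/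
noncomputable section

/-- The lift `ĝ(α, s) = (gα, u(α)·s)` of a lattice automorphism `g` (with sign datum `u`)
to a permutation of the double cover `L̂ = L × {±1}`. -/
def standardLiftPerm {L : Type*} [AddCommGroup L] (g : L ≃ₗ[ℤ] L) (u : L → ℤˣ) :
    Equiv.Perm (L × ℤˣ) where
  toFun p := (g p.1, u p.1 * p.2)
  invFun p := (g.symm p.1, (u (g.symm p.1))⁻¹ * p.2)
  left_inv := by
    rintro ⟨a, s⟩
    simp [← mul_assoc, Int.units_mul_self]
  right_inv := by
    rintro ⟨a, s⟩
    simp [← mul_assoc, Int.units_mul_self]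

/-- A reflection-invariant product of involutions with trivial initial factor collapses to its
middle factor. -/
lemma prod_range_eq_of_reflect {M : Type*} [CommMonoid M] (m : ℕ) (f : ℕ → M)
    (hsq : ∀ k, f k * f k = 1) (h0 : f 0 = 1) (href : ∀ k ≤ m, f (m - k) = f k) :
    ∏ k ∈ Finset.range m, f k = if Even m then f (m / 2) else 1 := by
  rcases Nat.eq_zero_or_pos m with rfl | hm
  · simp [h0]
  have hoff : ∏ k ∈ Finset.range m, (if 2 * k = m then 1 else f k) = 1 := by
    refine Finset.prod_involution (fun k _ => if k = 0 then 0 else m - k) ?_ ?_ ?_ ?_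
    · intro k hk
      have hkm := Finset.mem_range.mp hk
      by_cases hk0 : k = 0
      · simp [hk0, h0]
      · by_cases h : 2 * k = m
        · have h' : 2 * (m - k) = m := by omega
          simp [hk0, h, h']
        · have h' : ¬ 2 * (m - k) = m := by omega
          simp [hk0, h, h', href k hkm.le, hsq]
    · intro k hk hne
      have hkm := Finset.mem_range.mp hk
      by_cases hk0 : k = 0
      · simp [hk0, h0] at hne
      · by_cases h : 2 * k = m
        · simp [h] at hne
        · simp only [hk0, if_false]
          omega
    · intro k hk
      have hkm := Finset.mem_range.mp hk
      rw [Finset.mem_range]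
      split_ifs <;> omega
    · intro k hk
      have hkm := Finset.mem_range.mp hk
      split_ifs <;> omega
  have hsplit : ∀ k, f k = (if 2 * k = m then 1 else f k) * (if 2 * k = m then f k else 1) := by
    intro k
    split_ifs <;> simp
  rw [Finset.prod_congr rfl fun k _ => hsplit k, Finset.prod_mul_distrib, hoff, one_mul]
  split_ifs with he
  · obtain ⟨j, rfl⟩ := he
    rw [Finset.prod_eq_single ((j + j) / 2)]
    · rw [if_pos (by omega)]
    · intro k _ hk
      rw [if_neg (by omega)]
    · intro hk
      exact absurd (Finset.mem_range.mpr (by omega)) hk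
  · refine Finset.prod_eq_one fun k _ => ?_
    rw [if_neg]
    rintro rfl
    exact he (even_two_mul k)

lemma standardLiftPerm_pow_apply {L : Type*} [AddCommGroup L] (g : L ≃ₗ[ℤ] L) (u : L → ℤˣ)
    (n : ℕ) (α : L) (s : ℤˣ) :
    (standardLiftPerm g u ^ n) (α, s) =
      ((g ^ n) α, (∏ k ∈ Finset.range n, u ((g ^ k) α)) * s) := by
  induction n with
  | zero => simp
  | succ n ih =>
    rw [pow_succ', Equiv.Perm.mul_apply, ih, pow_succ', Finset.prod_range_succ]
    simp only [standardLiftPerm, Equiv.coe_fn_mk, LinearEquiv.mul_apply, Prod.mk.injEq, true_and]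
    rw [← mul_assoc, mul_comm (u _)]

/-- The sign of the lift on a partial orbit sum, compared with the product of the signs along
the orbit. -/
lemma lift_sign_orbit_sum {L : Type*} [AddCommGroup L] (ε : L → L → ℤˣ)
    (hcoc : ∀ α β γ : L, ε α β * ε (α + β) γ = ε β γ * ε α (β + γ))
    (hnorm : ∀ α : L, ε α 0 = 1 ∧ ε 0 α = 1)
    (g : L ≃ₗ[ℤ] L) (u : L → ℤˣ) (hu0 : u 0 = 1)
    (hu : ∀ α β : L, ε (g α) (g β) * u α * u β = ε α β * u (α + β)) (α : L) (n : ℕ) :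
    u (∑ k ∈ Finset.range n, (g ^ k) α) =
      (∏ k ∈ Finset.range n, u ((g ^ k) α)) *
        (ε α (g (∑ k ∈ Finset.range n, (g ^ k) α)) *
          ε (∑ k ∈ Finset.range n, (g ^ k) α) ((g ^ n) α)) := by
  induction n with
  | zero => simp [hu0, hnorm]
  | succ n ih =>
    have hshift : α + g (∑ k ∈ Finset.range n, (g ^ k) α) =
        (∑ k ∈ Finset.range n, (g ^ k) α) + (g ^ n) α := by
      rw [← Finset.sum_range_succ, Finset.sum_range_succ', map_sum, add_comm]
      simp [pow_succ']
    rw [Finset.sum_range_succ, Finset.prod_range_succ, map_add]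
    generalize (∑ k ∈ Finset.range n, (g ^ k) α) = β at *
    have hc := hcoc α (g β) (g ((g ^ n) α))
    have hb := hu β ((g ^ n) α)
    rw [hshift] at hc
    have hpow : (g ^ (n + 1)) α = g ((g ^ n) α) := by rw [pow_succ', LinearEquiv.mul_apply]
    rw [hpow]
    rw [ih] at hb
    generalize (∏ k ∈ Finset.range n, u ((g ^ k) α)) = v at *
    generalize u (β + (g ^ n) α) = a at *
    generalize u ((g ^ n) α) = b at *
    generalize ε (g β) (g ((g ^ n) α)) = c at *
    generalize ε β ((g ^ n) α) = d at *
    generalize ε α (g β) = e at *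
    generalize ε (β + (g ^ n) α) (g ((g ^ n) α)) = p at *
    generalize ε α (g β + g ((g ^ n) α)) = q at *
    have hp : p = e * c * q := by
      rw [mul_assoc, ← hc, ← mul_assoc, Int.units_mul_self, one_mul]
    have ha : a = d * (c * (v * (e * d)) * b) := by
      rw [hb, ← mul_assoc, Int.units_mul_self, one_mul]
    rw [hp, ha]
    calc d * (c * (v * (e * d)) * b) = (d * d) * (v * b * (e * c)) := by
          simp only [mul_comm, mul_left_comm]
      _ = (q * q) * (v * b * (e * c)) := by simp only [Int.units_mul_self]
      _ = v * b * (q * (e * c * q)) := by simp only [mul_comm, mul_left_comm]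

/-- The product of the lift signs along an orbit of a standard lift. -/
lemma prod_lift_sign_orbit {L : Type*} [AddCommGroup L]
    (B : L →ₗ[ℤ] L →ₗ[ℤ] ℤ) (hBsymm : ∀ α β : L, B α β = B β α)
    (hBeven : ∀ α : L, 2 ∣ B α α) (ε : L → L → ℤˣ)
    (hcoc : ∀ α β γ : L, ε α β * ε (α + β) γ = ε β γ * ε α (β + γ))
    (hnorm : ∀ α : L, ε α 0 = 1 ∧ ε 0 α = 1)
    (hskew : ∀ α β : L, ε α β = (-1 : ℤˣ) ^ (B α β) * ε β α)
    (g : L ≃ₗ[ℤ] L) (hg : ∀ α β : L, B (g α) (g β) = B α β)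
    (m : ℕ) (hgm : g ^ m = 1) (u : L → ℤˣ) (hu0 : u 0 = 1)
    (hu : ∀ α β : L, ε (g α) (g β) * u α * u β = ε α β * u (α + β))
    (hstd : ∀ β : L, g β = β → u β = 1) (α : L) :
    ∏ k ∈ Finset.range m, u ((g ^ k) α) =
      if Even m then (-1 : ℤˣ) ^ (B α ((g ^ (m / 2)) α)) else 1 := by
  have hgpow : ∀ (k : ℕ) (x y : L), B ((g ^ k) x) ((g ^ k) y) = B x y := by
    intro k
    induction k with
    | zero => simp
    | succ k ih =>
      intro x y
      rw [pow_succ', LinearEquiv.mul_apply, LinearEquiv.mul_apply, hg, ih]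
  rw [← prod_range_eq_of_reflect m (fun k => (-1 : ℤˣ) ^ (B α ((g ^ k) α)))
    (fun k => Int.units_mul_self _)
    (by simpa using Even.neg_one_zpow (even_iff_two_dvd.mpr (hBeven α)))
    (fun k hk => by
      rw [← hgpow k α ((g ^ (m - k)) α), ← LinearEquiv.mul_apply, ← pow_add,
        Nat.add_sub_cancel' hk, hgm, hBsymm]
      rfl)]
  have hfix : g (∑ k ∈ Finset.range m, (g ^ k) α) = ∑ k ∈ Finset.range m, (g ^ k) α := by
    have h := Finset.sum_range_succ' (fun k => (g ^ k) α) m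
    rw [Finset.sum_range_succ, hgm, pow_zero] at h
    rw [map_sum, add_right_cancel h]
    simp [pow_succ']
  have h := lift_sign_orbit_sum ε hcoc hnorm g u hu0 hu α m
  rw [hstd _ hfix, hfix, hgm, LinearEquiv.coe_one, id, hskew α, mul_assoc, Int.units_mul_self,
    mul_one, map_sum] at h
  have hz : (-1 : ℤˣ) ^ (∑ k ∈ Finset.range m, B α ((g ^ k) α)) =
      ∏ k ∈ Finset.range m, (-1 : ℤˣ) ^ (B α ((g ^ k) α)) := by
    induction Finset.range m using Finset.induction_on with
    | empty => simp
    | insert a s ha ih => rw [Finset.sum_insert ha, Finset.prod_insert ha, zpow_add, ih]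
  rw [← hz, ← inv_eq_of_mul_eq_one_left h.symm, Int.units_inv_eq_self]

/-- **Order (doubling) criterion for standard lifts.**
Let `L` be a free `ℤ`-module of finite rank with an even symmetric bilinear form `B`,
`ε` a normalized 2-cocycle satisfying the skew condition for `B`, `g` an isometry of
`(L, B)` of exact order `m`, and `u` a standard lift datum (`u = 1` on the fixed points
of `g`).  Then the induced automorphism `ĝ` of the double cover has order `m` if `m` is
odd; if `m` is even it has order `m` when `B(α, g^{m/2}α)` is always even, and
order `2m` otherwise. -/
theorem standardLift_order {L : Type*} [AddCommGroup L] [Module.Free ℤ L] [Module.Finite ℤ L]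
    (B : L →ₗ[ℤ] L →ₗ[ℤ] ℤ) (hBsymm : ∀ α β : L, B α β = B β α)
    (hBeven : ∀ α : L, 2 ∣ B α α)
    (ε : L → L → ℤˣ)
    (hcoc : ∀ α β γ : L, ε α β * ε (α + β) γ = ε β γ * ε α (β + γ))
    (hnorm : ∀ α : L, ε α 0 = 1 ∧ ε 0 α = 1)
    (hskew : ∀ α β : L, ε α β = (-1 : ℤˣ) ^ (B α β) * ε β α)
    (g : L ≃ₗ[ℤ] L) (hg : ∀ α β : L, B (g α) (g β) = B α β)
    (m : ℕ) (hm : 0 < m) (hord : orderOf g = m)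
    (u : L → ℤˣ) (hu0 : u 0 = 1)
    (hu : ∀ α β : L, ε (g α) (g β) * u α * u β = ε α β * u (α + β))
    (hstd : ∀ β : L, g β = β → u β = 1) :
    (Odd m → orderOf (standardLiftPerm g u) = m) ∧
    (Even m →
      ((∀ α : L, 2 ∣ B α ((g ^ (m / 2)) α)) → orderOf (standardLiftPerm g u) = m) ∧
      (¬ (∀ α : L, 2 ∣ B α ((g ^ (m / 2)) α)) → orderOf (standardLiftPerm g u) = 2 * m)) := by
  have hgm : g ^ m = 1 := hord ▸ pow_orderOf_eq_one g
  have hprod := prod_lift_sign_orbit B hBsymm hBeven ε hcoc hnorm hskew g hg m hgm u hu0 hu hstd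
  have hdvd : m ∣ orderOf (standardLiftPerm g u) := by
    rw [← hord]
    refine orderOf_dvd_of_pow_eq_one (LinearEquiv.ext fun α => ?_)
    have h := standardLiftPerm_pow_apply g u (orderOf (standardLiftPerm g u)) α 1
    rw [pow_orderOf_eq_one] at h
    exact (congrArg Prod.fst h).symm
  have hiff : standardLiftPerm g u ^ m = 1 ↔ ∀ α, ∏ k ∈ Finset.range m, u ((g ^ k) α) = 1 := by
    constructor
    · intro h α
      have h' := standardLiftPerm_pow_apply g u m α 1
      rw [h, mul_one] at h'
      exact (congrArg Prod.snd h').symm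
    · rintro h
      ext1 ⟨α, s⟩
      rw [standardLiftPerm_pow_apply, h, hgm, one_mul]
      rfl
  refine ⟨fun hodd => ?_, fun heven => ⟨fun h => ?_, fun h => ?_⟩⟩
  · refine Nat.dvd_antisymm (orderOf_dvd_of_pow_eq_one (hiff.mpr fun α => ?_)) hdvd
    rw [hprod, if_neg (Nat.not_even_iff_odd.mpr hodd)]
  · refine Nat.dvd_antisymm (orderOf_dvd_of_pow_eq_one (hiff.mpr fun α => ?_)) hdvd
    rw [hprod, if_pos heven, Even.neg_one_zpow (even_iff_two_dvd.mpr (h α))]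
  · have hsq : standardLiftPerm g u ^ (2 * m) = 1 := by
      rw [mul_comm, pow_mul, sq]
      ext1 ⟨α, s⟩
      rw [Equiv.Perm.mul_apply, standardLiftPerm_pow_apply, standardLiftPerm_pow_apply, hgm,
        LinearEquiv.coe_one]
      dsimp only [id]
      rw [← mul_assoc, Int.units_mul_self, one_mul]
      rfl
    have hne : ¬ standardLiftPerm g u ^ m = 1 := by
      rw [hiff]
      push Not at h ⊢
      obtain ⟨α, hα⟩ := h
      refine ⟨α, ?_⟩
      rw [hprod, if_pos heven, Odd.neg_one_zpow]
      · decide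
      · rwa [← Int.not_even_iff_odd, even_iff_two_dvd]
    obtain ⟨k, hk⟩ := hdvd
    have hk2 : k ∣ 2 := by
      have h2 := orderOf_dvd_of_pow_eq_one hsq
      rw [hk, mul_comm 2 m] at h2
      exact Nat.dvd_of_mul_dvd_mul_left hm h2
    rcases (Nat.dvd_prime Nat.prime_two).mp hk2 with rfl | rfl
    · rw [mul_one] at hk
      exact absurd (orderOf_dvd_iff_pow_eq_one.mp hk.dvd) hne
    · rw [hk, mul_comm]

end
end

section
/- Let τ ∈ ℂ with Im τ > 0, and let E₈ = {x ∈ ℝ⁸ : (all xᵢ ∈ ℤ or all xᵢ ∈ ℤ + 1/2) and ∑ᵢ xᵢ ∈ 2ℤ}. Then ∑_{ξ ∈ E₈} exp(πiτ·⟪ξ, ξ⟫) = (1/2)·(θ₂(τ)⁸ + θ₃(τ)⁸ + θ₄(τ)⁸), where ⟪·,·⟫ is the standard dot product on ℝ⁸. -/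
noncomputable section


/-- The Jacobi theta constant `θ₂(τ) = ∑_{n ∈ ℤ} exp(πiτ(n + 1/2)²)`. -/
def jacobiTheta2 (τ : ℂ) : ℂ :=
  ∑' n : ℤ, Complex.exp ((Real.pi : ℂ) * Complex.I * τ * ((n : ℂ) + 1 / 2) ^ 2)

/-- The Jacobi theta constant `θ₃(τ) = ∑_{n ∈ ℤ} exp(πiτn²)`. -/
def jacobiTheta3 (τ : ℂ) : ℂ :=
  ∑' n : ℤ, Complex.exp ((Real.pi : ℂ) * Complex.I * τ * (n : ℂ) ^ 2)

/-- The Jacobi theta constant `θ₄(τ) = ∑_{n ∈ ℤ} (−1)ⁿ exp(πiτn²)`. -/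
def jacobiTheta4 (τ : ℂ) : ℂ :=
  ∑' n : ℤ, (-1 : ℂ) ^ n * Complex.exp ((Real.pi : ℂ) * Complex.I * τ * (n : ℂ) ^ 2)

/-- The `E₈` root lattice, realized as the set of vectors of `ℝ⁸` whose coordinates are
either all integers or all half-integers, and whose coordinate sum is even. -/
def E8Set : Set (Fin 8 → ℝ) :=
  {x | ((∀ i, ∃ k : ℤ, x i = (k : ℝ)) ∨ (∀ i, ∃ k : ℤ, x i = (k : ℝ) + 1 / 2)) ∧
    ∃ k : ℤ, ∑ i, x i = 2 * (k : ℝ)}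

/-- The sum of a product of copies of `f` over vectors of length `n` is the `n`-th power
of the sum of `f`. -/
theorem hasSum_prod_pow {ι : Type*} {f : ι → ℂ} (hf : Summable fun k => ‖f k‖) (n : ℕ) :
    (Summable fun v : Fin n → ι => ‖∏ i, f (v i)‖) ∧
      HasSum (fun v : Fin n → ι => ∏ i, f (v i)) ((∑' k, f k) ^ n) := by
  induction n with
  | zero =>
    refine ⟨Summable.of_finite, ?_⟩
    simp
  | succ n ih =>
    obtain ⟨hs, hv⟩ := ih
    rw [← (Fin.consEquiv fun _ => ι).summable_iff, ← (Fin.consEquiv fun _ => ι).hasSum_iff]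
    have hprod : (fun v : Fin (n + 1) → ι => ∏ i, f (v i)) ∘ Fin.consEquiv (fun _ => ι) =
        fun p : ι × (Fin n → ι) => f p.1 * ∏ i, f (p.2 i) := by
      funext p
      simp [Fin.consEquiv, Fin.prod_univ_succ]
    have hnorm : (fun v : Fin (n + 1) → ι => ‖∏ i, f (v i)‖) ∘ Fin.consEquiv (fun _ => ι) =
        fun p : ι × (Fin n → ι) => ‖f p.1 * ∏ i, f (p.2 i)‖ := by
      funext p
      exact congrArg norm (congrFun hprod p)
    rw [hprod, hnorm, pow_succ']
    have hmul := Summable.mul_norm (f := f) (g := fun v : Fin n → ι => ∏ i, f (v i)) hf hs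
    have hsum : HasSum f (∑' k, f k) := (Summable.of_norm hf).hasSum
    exact ⟨hmul, HasSum.mul (f := f) (g := fun v : Fin n → ι => ∏ i, f (v i)) hsum hv
      (Summable.of_norm hmul)⟩

/-- Restricting to vectors with even coordinate sum averages `f` with its alternating twist. -/
theorem hasSum_prod_even {f : ℤ → ℂ} (hf : Summable fun k => ‖f k‖) (n : ℕ) :
    HasSum (fun v : {v : Fin n → ℤ | Even (∑ i, v i)} => ∏ i, f (v.1 i))
      (1 / 2 * ((∑' k, f k) ^ n + (∑' k, (-1 : ℂ) ^ k * f k) ^ n)) := by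
  have hf' : Summable fun k : ℤ => ‖(-1 : ℂ) ^ k * f k‖ := by simpa using hf
  have h := ((hasSum_prod_pow hf n).2.add (hasSum_prod_pow hf' n).2).mul_left (1 / 2)
  refine (hasSum_subtype_iff_indicator (f := fun v : Fin n → ℤ => ∏ i, f (v i))).2 ?_
  refine h.congr_fun fun v => ?_
  have hsign : ∏ i, (-1 : ℂ) ^ v i = (-1) ^ ∑ i, v i := by
    induction (Finset.univ : Finset (Fin n)) using Finset.cons_induction with
    | empty => simp
    | cons a s ha ih => rw [Finset.prod_cons, Finset.sum_cons, zpow_add₀ (by simp), ih]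
  rw [Finset.prod_mul_distrib, hsign]
  by_cases hv : Even (∑ i, v i)
  · rw [Set.indicator_of_mem (by exact hv), hv.neg_one_zpow]
    ring
  · rw [Set.indicator_of_notMem (by exact hv), (Int.not_even_iff_odd.1 hv).neg_one_zpow]
    ring

/-- The Gaussian terms of a shifted one-dimensional theta series are absolutely summable. -/
theorem summable_norm_theta_term {τ : ℂ} (hτ : 0 < τ.im) (c : ℂ) :
    Summable fun k : ℤ => ‖Complex.exp ((Real.pi : ℂ) * Complex.I * τ * ((k : ℂ) + c) ^ 2)‖ := by
  have h := (((summable_jacobiTheta₂_term_iff (c * τ) τ).2 hτ).mul_left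
    (Complex.exp ((Real.pi : ℂ) * Complex.I * τ * c ^ 2))).norm
  refine h.congr fun k => ?_
  rw [jacobiTheta₂_term, ← Complex.exp_add]
  ring_nf

/-- The translate by `(c, …, c)` of the integer vectors with even coordinate sum. -/
def evenCoset (n : ℕ) (c : ℝ) : Set (Fin n → ℝ) :=
  (fun (v : Fin n → ℤ) i => (v i : ℝ) + c) '' {v | Even (∑ i, v i)}

theorem hasSum_evenCoset {τ : ℂ} (hτ : 0 < τ.im) (n : ℕ) (c : ℝ) :
    HasSum ((fun x : Fin n → ℝ => Complex.exp ((Real.pi : ℂ) * Complex.I * τ *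
        ((∑ i, x i ^ 2 : ℝ) : ℂ))) ∘ ((↑) : evenCoset n c → Fin n → ℝ))
      (1 / 2 * ((∑' k : ℤ, Complex.exp ((Real.pi : ℂ) * Complex.I * τ * ((k : ℂ) + c) ^ 2)) ^ n +
        (∑' k : ℤ, (-1 : ℂ) ^ k *
          Complex.exp ((Real.pi : ℂ) * Complex.I * τ * ((k : ℂ) + c) ^ 2)) ^ n)) := by
  have hinj : Function.Injective fun (v : Fin n → ℤ) i => (v i : ℝ) + c := by
    intro v w h
    funext i
    simpa using congrFun h i
  rw [evenCoset]
  refine (Equiv.Set.image _ {v : Fin n → ℤ | Even (∑ i, v i)} hinj).hasSum_iff.1 ?_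
  refine (hasSum_prod_even (summable_norm_theta_term hτ c) n).congr_fun fun v => ?_
  simp only [Function.comp_apply, Equiv.Set.image_apply, ← Complex.exp_sum]
  push_cast
  rw [Finset.mul_sum]

theorem E8Set_eq_union_evenCoset : E8Set = evenCoset 8 0 ∪ evenCoset 8 (1 / 2) := by
  ext x
  constructor
  · rintro ⟨h | h, m, hm⟩
    · choose v hv using h
      refine Or.inl ⟨v, ⟨m, ?_⟩, funext fun i => by simp [hv]⟩
      simp only [hv] at hm
      rw [← two_mul]
      exact_mod_cast hm
    · choose v hv using h
      refine Or.inr ⟨v, ⟨m - 2, ?_⟩, funext fun i => (hv i).symm⟩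
      simp only [hv, Finset.sum_add_distrib, Finset.sum_const, Finset.card_univ,
        Fintype.card_fin, nsmul_eq_mul] at hm
      have : ((∑ i, v i : ℤ) : ℝ) = ((m - 2 + (m - 2) : ℤ) : ℝ) := by
        push_cast at hm ⊢
        linarith
      exact_mod_cast this
  · rintro (⟨v, ⟨m, hm⟩, rfl⟩ | ⟨v, ⟨m, hm⟩, rfl⟩)
    · refine ⟨Or.inl fun i => ⟨v i, by simp⟩, m, ?_⟩
      have : ((∑ i, v i : ℤ) : ℝ) = ((m + m : ℤ) : ℝ) := congrArg _ hm
      push_cast at this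
      simp only [add_zero]
      linarith
    · refine ⟨Or.inr fun i => ⟨v i, rfl⟩, m + 2, ?_⟩
      have : ((∑ i, v i : ℤ) : ℝ) = ((m + m : ℤ) : ℝ) := congrArg _ hm
      push_cast at this
      simp only [Finset.sum_add_distrib, Finset.sum_const, Finset.card_univ,
        Fintype.card_fin, nsmul_eq_mul]
      push_cast
      linarith

theorem disjoint_evenCoset_zero_half : Disjoint (evenCoset 8 0) (evenCoset 8 (1 / 2)) := by
  rw [Set.disjoint_left]
  rintro _ ⟨v, -, rfl⟩ ⟨w, -, h⟩
  have h0 : (w 0 : ℝ) + 1 / 2 = v 0 + 0 := congrFun h 0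
  have h1 : ((2 * w 0 + 1 : ℤ) : ℝ) = ((2 * v 0 : ℤ) : ℝ) := by
    push_cast
    linarith
  have h2 : 2 * w 0 + 1 = 2 * v 0 := by exact_mod_cast h1
  omega

/-- The alternating half-integer theta series vanishes, by the symmetry `k ↦ -1 - k`. -/
theorem tsum_alternating_half_theta (τ : ℂ) :
    ∑' k : ℤ, (-1 : ℂ) ^ k *
      Complex.exp ((Real.pi : ℂ) * Complex.I * τ * ((k : ℂ) + 1 / 2) ^ 2) = 0 := by
  rw [← self_eq_neg]
  conv_lhs => rw [← (Equiv.subLeft (-1 : ℤ)).tsum_eq]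
  rw [← tsum_neg]
  refine tsum_congr fun k => ?_
  have hsign : (-1 : ℂ) ^ (-1 - k) = -(-1) ^ k := by
    rw [zpow_sub₀ (by simp), div_eq_mul_inv, ← inv_zpow]
    norm_num
  rw [Equiv.subLeft_apply, hsign, neg_mul]
  push_cast
  ring_nf

/-- **The theta function of the `E₈` lattice.**
For `τ` in the upper half-plane,
`∑_{ξ ∈ E₈} exp(πiτ⟪ξ,ξ⟫) = (1/2)(θ₂(τ)⁸ + θ₃(τ)⁸ + θ₄(τ)⁸)`. -/
theorem E8_theta_identity (τ : ℂ) (hτ : 0 < τ.im) :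
    ∑' ξ : E8Set, Complex.exp ((Real.pi : ℂ) * Complex.I * τ *
        ((∑ i, (ξ : Fin 8 → ℝ) i ^ 2 : ℝ) : ℂ)) =
      (1 / 2) * (jacobiTheta2 τ ^ 8 + jacobiTheta3 τ ^ 8 + jacobiTheta4 τ ^ 8) := by
  have h := (hasSum_evenCoset hτ 8 0).add_disjoint disjoint_evenCoset_zero_half
    (hasSum_evenCoset hτ 8 (1 / 2))
  rw [← E8Set_eq_union_evenCoset] at h
  refine h.tsum_eq.trans ?_
  push_cast
  simp only [add_zero]
  rw [tsum_alternating_half_theta, jacobiTheta2, jacobiTheta3, jacobiTheta4]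
  ring

end
end

section
/- Let τ ∈ ℂ with Im τ > 0, let Θ_{A₂}(τ) = ∑_{(m,n)∈ℤ²} exp(2πiτ(m² − mn + n²)), and let E₈ = {x ∈ ℝ⁸ : (all xᵢ ∈ ℤ or all xᵢ ∈ ℤ + 1/2) and ∑ᵢ xᵢ ∈ 2ℤ}. Then ∑_{ξ ∈ E₈} exp(πiτ·⟪ξ, ξ⟫) = Θ_{A₂}(τ)·( (Θ_{A₂}(τ/3) − Θ_{A₂}(τ))³ + Θ_{A₂}(τ)³ ). -/
noncomputable section

/-- The theta function of the hexagonal root lattice `A₂`: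
`Θ_{A₂}(τ) = ∑_{(m,n) ∈ ℤ²} exp(2πiτ(m² − mn + n²))`. -/
def thetaA2 (τ : ℂ) : ℂ :=
  ∑' p : ℤ × ℤ, Complex.exp (2 * (Real.pi : ℂ) * Complex.I * τ *
    ((p.1 : ℂ) ^ 2 - (p.1 : ℂ) * (p.2 : ℂ) + (p.2 : ℂ) ^ 2))

/-- The summand of the theta function of `A₂`. -/
def thetaA2Term (τ : ℂ) (p : ℤ × ℤ) : ℂ :=
  Complex.exp (2 * (Real.pi : ℂ) * Complex.I * τ *
    ((p.1 : ℂ) ^ 2 - (p.1 : ℂ) * (p.2 : ℂ) + (p.2 : ℂ) ^ 2))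

/-- Identifying `(m, n)` with the Eisenstein integer `m + nω`, the affine map
`z ↦ (1 - ω)z + c`. -/
def eisensteinCoset (c : ℤ) (q : ℤ × ℤ) : ℤ × ℤ :=
  (q.1 + q.2 + c, 2 * q.2 - q.1)

/-- The theta function of the coset of `A₂` in its dual lattice labelled by `c` modulo `3`. -/
def thetaA2Coset (τ : ℂ) (c : ℤ) : ℂ :=
  ∑' q, thetaA2Term (τ / 3) (eisensteinCoset c q)

lemma summable_norm_thetaA2Term {τ : ℂ} (hτ : 0 < τ.im) :
    Summable fun p => ‖thetaA2Term τ p‖ := by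
  have hs : Summable fun n : ℤ => ‖Complex.exp (Real.pi * Complex.I * (n : ℂ) ^ 2 * τ)‖ :=
    by simpa [jacobiTheta₂_term] using ((summable_jacobiTheta₂_term_iff 0 τ).mpr hτ).norm
  refine Summable.of_nonneg_of_le (fun _ => norm_nonneg _) (fun p => ?_)
    (hs.mul_of_nonneg hs (fun _ => norm_nonneg _) (fun _ => norm_nonneg _))
  rw [thetaA2Term, Complex.norm_exp, Complex.norm_exp, Complex.norm_exp, ← Real.exp_add]
  apply Real.exp_le_exp.mpr
  have h (r : ℝ) : (Real.pi * Complex.I * τ * (r : ℂ)).re = -(Real.pi * τ.im * r) := by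
    simp
  have e₁ : 2 * (Real.pi : ℂ) * Complex.I * τ *
      ((p.1 : ℂ) ^ 2 - (p.1 : ℂ) * (p.2 : ℂ) + (p.2 : ℂ) ^ 2) =
      Real.pi * Complex.I * τ * ((2 * ((p.1 : ℝ) ^ 2 - p.1 * p.2 + (p.2 : ℝ) ^ 2) : ℝ) : ℂ) := by
    push_cast; ring
  have e₂ (n : ℤ) : Real.pi * Complex.I * (n : ℂ) ^ 2 * τ =
      Real.pi * Complex.I * τ * (((n : ℝ) ^ 2 : ℝ) : ℂ) := by
    push_cast; ring
  rw [e₁, e₂, e₂, h, h, h]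
  nlinarith [mul_nonneg (mul_pos Real.pi_pos hτ).le (sq_nonneg ((p.1 : ℝ) - p.2))]

lemma eisensteinCoset_injective (c : ℤ) : Function.Injective (eisensteinCoset c) := by
  rintro ⟨m, n⟩ ⟨m', n'⟩ h
  simp only [eisensteinCoset, Prod.mk.injEq] at h ⊢
  omega

lemma summable_norm_thetaA2Coset {τ : ℂ} (hτ : 0 < τ.im) (c : ℤ) :
    Summable fun q => ‖thetaA2Term (τ / 3) (eisensteinCoset c q)‖ := by
  have h : 0 < (τ / 3).im := by
    rw [show τ / 3 = τ / ((3 : ℝ) : ℂ) by norm_num, Complex.div_ofReal_im]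
    positivity
  exact (summable_norm_thetaA2Term h).comp_injective (eisensteinCoset_injective c)

lemma thetaA2Coset_zero (τ : ℂ) : thetaA2Coset τ 0 = thetaA2 τ := by
  refine tsum_congr fun p => ?_
  simp only [thetaA2Term, eisensteinCoset]
  congr 1
  push_cast
  ring

lemma thetaA2Coset_add_three (τ : ℂ) (c : ℤ) :
    thetaA2Coset τ (c + 3) = thetaA2Coset τ c := by
  rw [thetaA2Coset, thetaA2Coset, ← (Equiv.addRight ((2, 1) : ℤ × ℤ)).tsum_eq
    (fun q => thetaA2Term (τ / 3) (eisensteinCoset c q))]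
  refine tsum_congr fun p => ?_
  simp only [thetaA2Term, eisensteinCoset, Equiv.coe_addRight, Prod.fst_add, Prod.snd_add]
  congr 1
  push_cast
  ring

lemma thetaA2Coset_neg (τ : ℂ) (c : ℤ) : thetaA2Coset τ (-c) = thetaA2Coset τ c := by
  rw [thetaA2Coset, thetaA2Coset, ← (Equiv.neg (ℤ × ℤ)).tsum_eq
    (fun q => thetaA2Term (τ / 3) (eisensteinCoset c q))]
  refine tsum_congr fun p => ?_
  simp only [thetaA2Term, eisensteinCoset, Equiv.neg_apply, Prod.fst_neg, Prod.snd_neg]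
  congr 1
  push_cast
  ring

/-- Summation over a product with a finite first factor. -/
lemma tsum_prod_of_fintype {ι X : Type*} [Fintype ι] {f : ι × X → ℂ}
    (hf : ∀ i, Summable fun x => ‖f (i, x)‖) :
    ∑' y, f y = ∑ i, ∑' x, f (i, x) := by
  have h : Summable f := by
    refine Summable.of_norm ((summable_prod_of_nonneg fun _ => norm_nonneg _).mpr
      ⟨hf, (hasSum_fintype _).summable⟩)
  rw [h.tsum_prod' fun i => (hf i).of_norm, tsum_fintype]

lemma eisensteinCoset_bijective :
    Function.Bijective fun y : Fin 3 × (ℤ × ℤ) => eisensteinCoset (y.1 : ℕ) y.2 := by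
  constructor
  · rintro ⟨a, m, n⟩ ⟨a', m', n'⟩ h
    simp only [eisensteinCoset, Prod.mk.injEq, Fin.ext_iff] at h ⊢
    omega
  · rintro ⟨u, v⟩
    refine ⟨(⟨((u + v) % 3).toNat, by omega⟩, (2 * ((u + v) / 3) - v, (u + v) / 3)), ?_⟩
    simp only [eisensteinCoset, Prod.mk.injEq]
    omega

lemma thetaA2Coset_two (τ : ℂ) : thetaA2Coset τ 2 = thetaA2Coset τ 1 := by
  rw [← thetaA2Coset_neg τ 1, ← thetaA2Coset_add_three τ (-1)]
  norm_num

lemma thetaA2_div_three {τ : ℂ} (hτ : 0 < τ.im) :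
    thetaA2 (τ / 3) = thetaA2 τ + 2 * thetaA2Coset τ 1 := by
  have h : thetaA2 (τ / 3) = ∑ a : Fin 3, thetaA2Coset τ (a : ℕ) := by
    have hθ : thetaA2 (τ / 3) = ∑' p, thetaA2Term (τ / 3) p := rfl
    rw [hθ, ← (Equiv.ofBijective _ eisensteinCoset_bijective).tsum_eq]
    simp only [Equiv.ofBijective_apply]
    rw [tsum_prod_of_fintype]
    · simp only [thetaA2Coset]
    · exact fun a => summable_norm_thetaA2Coset hτ (a : ℕ)
  rw [h, Fin.sum_univ_three]
  simp only [Fin.val_zero, Fin.val_one, Fin.val_two, Nat.cast_zero, Nat.cast_one, Nat.cast_ofNat,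
    thetaA2Coset_two, thetaA2Coset_zero]
  ring

/-- The parameters of a vector of `E₈` relative to the sublattice `A₂⁴`: a pair in `𝔽₃²`
labelling a word of the tetracode, and a vector of `A₂⁴`. -/
abbrev TetracodeIndex : Type :=
  (Fin 3 × Fin 3) × ((ℤ × ℤ) × (ℤ × ℤ)) × ((ℤ × ℤ) × (ℤ × ℤ))

/-- The vector of `E₈` with given parameters relative to the sublattice `A₂⁴` whose factors are
spanned by `(e₁ - e₂, e₂ - e₃)`, `(e₄ - e₅, e₅ - e₆)`, `(e₇ + e₈, (½, ½, ½, ½, ½, ½, -½, -½))` and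
`(e₇ - e₈, (½, ½, ½, -½, -½, -½, -½, ½))`; the glue vectors are `e₁ + e₇` and `e₄ + e₈`. -/
def e8Vector : TetracodeIndex → Fin 8 → ℝ
  | ((a, b), ((m₀, n₀), (m₁, n₁)), ((m₂, n₂), (m₃, n₃))) =>
    ![m₀ + (n₂ + n₃) / 2 + (a : ℕ), -m₀ + n₀ + (n₂ + n₃) / 2, -n₀ + (n₂ + n₃) / 2,
      m₁ + (n₂ - n₃) / 2 + (b : ℕ), -m₁ + n₁ + (n₂ - n₃) / 2, -n₁ + (n₂ - n₃) / 2,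
      m₂ + m₃ - (n₂ + n₃) / 2 + (a : ℕ), m₂ - m₃ - (n₂ - n₃) / 2 + (b : ℕ)]

lemma e8Vector_mem (y : TetracodeIndex) : e8Vector y ∈ E8Set := by
  obtain ⟨⟨a, b⟩, ⟨⟨m₀, n₀⟩, ⟨m₁, n₁⟩⟩, ⟨⟨m₂, n₂⟩, ⟨m₃, n₃⟩⟩⟩ := y
  refine ⟨?_, n₂ + m₂ + (a : ℕ) + (b : ℕ), ?_⟩
  · obtain ⟨k, hk | hk⟩ := Int.even_or_odd' (n₂ + n₃)
    · left
      obtain rfl : n₂ = 2 * k - n₃ := by omega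
      intro i
      fin_cases i
      · exact ⟨m₀ + k + (a : ℕ), by simp [e8Vector]⟩
      · exact ⟨-m₀ + n₀ + k, by simp [e8Vector]⟩
      · exact ⟨-n₀ + k, by simp [e8Vector]⟩
      · exact ⟨m₁ + k - n₃ + (b : ℕ), by simp [e8Vector]; ring⟩
      · exact ⟨-m₁ + n₁ + k - n₃, by simp [e8Vector]; ring⟩
      · exact ⟨-n₁ + k - n₃, by simp [e8Vector]; ring⟩
      · exact ⟨m₂ + m₃ - k + (a : ℕ), by simp [e8Vector]⟩
      · exact ⟨m₂ - m₃ - k + n₃ + (b : ℕ), by simp [e8Vector]; ring⟩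
    · right
      obtain rfl : n₂ = 2 * k + 1 - n₃ := by omega
      intro i
      fin_cases i
      · exact ⟨m₀ + k + (a : ℕ), by simp [e8Vector]; ring⟩
      · exact ⟨-m₀ + n₀ + k, by simp [e8Vector]; ring⟩
      · exact ⟨-n₀ + k, by simp [e8Vector]; ring⟩
      · exact ⟨m₁ + k - n₃ + (b : ℕ), by simp [e8Vector]; ring⟩
      · exact ⟨-m₁ + n₁ + k - n₃, by simp [e8Vector]; ring⟩
      · exact ⟨-n₁ + k - n₃, by simp [e8Vector]; ring⟩
      · exact ⟨m₂ + m₃ - k - 1 + (a : ℕ), by simp [e8Vector]; ring⟩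
      · exact ⟨m₂ - m₃ - k - 1 + n₃ + (b : ℕ), by simp [e8Vector]; ring⟩
  · simp [e8Vector, Fin.sum_univ_eight]
    ring

lemma e8Vector_injective : Function.Injective e8Vector := by
  rintro ⟨⟨a, b⟩, ⟨⟨m₀, n₀⟩, ⟨m₁, n₁⟩⟩, ⟨⟨m₂, n₂⟩, ⟨m₃, n₃⟩⟩⟩
    ⟨⟨a', b'⟩, ⟨⟨m₀', n₀'⟩, ⟨m₁', n₁'⟩⟩, ⟨⟨m₂', n₂'⟩, ⟨m₃', n₃'⟩⟩⟩ h
  have h₀ := congrFun h 0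
  have h₁ := congrFun h 1
  have h₂ := congrFun h 2
  have h₃ := congrFun h 3
  have h₄ := congrFun h 4
  have h₅ := congrFun h 5
  have h₆ := congrFun h 6
  have h₇ := congrFun h 7
  simp [e8Vector] at h₀ h₁ h₂ h₃ h₄ h₅ h₆ h₇
  field_simp at h₀ h₁ h₂ h₃ h₄ h₅ h₆ h₇
  norm_cast at h₀ h₁ h₂ h₃ h₄ h₅ h₆ h₇
  simp only [Prod.mk.injEq, Fin.ext_iff]
  omega

lemma exists_e8Vector_eq {x : Fin 8 → ℝ} (hx : x ∈ E8Set) : ∃ y, e8Vector y = x := by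
  obtain ⟨hx, K, hK⟩ := hx
  obtain ⟨e, k, hk⟩ : ∃ e : ℤ, ∃ k : Fin 8 → ℤ, ∀ i, x i = k i + e / 2 := by
    rcases hx with hx | hx <;> choose k hk using hx
    · exact ⟨0, k, by simpa using hk⟩
    · exact ⟨1, k, by simpa using hk⟩
  have hsum : k 0 + k 1 + k 2 + k 3 + k 4 + k 5 + k 6 + k 7 + 4 * e = 2 * K := by
    rw [Fin.sum_univ_eight] at hK
    simp only [hk] at hK
    have : (k 0 + k 1 + k 2 + k 3 + k 4 + k 5 + k 6 + k 7 + 4 * e : ℝ) = 2 * K := by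
      linarith
    exact_mod_cast this
  obtain ⟨a, A, hA⟩ : ∃ a : Fin 3, ∃ A : ℤ, k 0 + k 1 + k 2 = 3 * A + (a : ℕ) :=
    ⟨⟨((k 0 + k 1 + k 2) % 3).toNat, by omega⟩, (k 0 + k 1 + k 2) / 3, by simp only; omega⟩
  obtain ⟨b, B, hB⟩ : ∃ b : Fin 3, ∃ B : ℤ, k 3 + k 4 + k 5 = 3 * B + (b : ℕ) :=
    ⟨⟨((k 3 + k 4 + k 5) % 3).toNat, by omega⟩, (k 3 + k 4 + k 5) / 3, by simp only; omega⟩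
  obtain ⟨m₂, h₂⟩ : ∃ m : ℤ, 2 * m = k 6 + k 7 + A + B + 2 * e - (a : ℕ) - (b : ℕ) :=
    ⟨(k 6 + k 7 + A + B + 2 * e - (a : ℕ) - (b : ℕ)) / 2, by omega⟩
  obtain ⟨m₃, h₃⟩ : ∃ m : ℤ, 2 * m = k 6 - k 7 + A - B - (a : ℕ) + (b : ℕ) :=
    ⟨(k 6 - k 7 + A - B - (a : ℕ) + (b : ℕ)) / 2, by omega⟩
  refine ⟨((a, b), ((k 0 - A - (a : ℕ), A - k 2), (k 3 - B - (b : ℕ), B - k 5)),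
    ((m₂, A + B + e), (m₃, A - B))), ?_⟩
  have hA' : (k 0 + k 1 + k 2 : ℝ) = 3 * A + (a : ℕ) := by exact_mod_cast hA
  have hB' : (k 3 + k 4 + k 5 : ℝ) = 3 * B + (b : ℕ) := by exact_mod_cast hB
  have h₂' : (2 * m₂ : ℝ) = k 6 + k 7 + A + B + 2 * e - (a : ℕ) - (b : ℕ) := by exact_mod_cast h₂
  have h₃' : (2 * m₃ : ℝ) = k 6 - k 7 + A - B - (a : ℕ) + (b : ℕ) := by exact_mod_cast h₃
  ext i
  rw [hk]
  fin_cases i <;> simp [e8Vector] <;> linarith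

/-- The decomposition of `E₈` into cosets of `A₂⁴`. -/
def e8Equiv : TetracodeIndex ≃ E8Set :=
  Equiv.ofBijective (fun y => ⟨e8Vector y, e8Vector_mem y⟩)
    ⟨fun _ _ h => e8Vector_injective (congrArg Subtype.val h),
      fun x => (exists_e8Vector_eq x.2).imp fun _ h => Subtype.ext h⟩

lemma exp_e8Vector (τ : ℂ) (y : TetracodeIndex) :
    Complex.exp ((Real.pi : ℂ) * Complex.I * τ * ((∑ i, e8Vector y i ^ 2 : ℝ) : ℂ)) =
      (thetaA2Term (τ / 3) (eisensteinCoset (y.1.1 : ℕ) y.2.1.1) *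
        thetaA2Term (τ / 3) (eisensteinCoset (y.1.2 : ℕ) y.2.1.2)) *
      (thetaA2Term (τ / 3) (eisensteinCoset ((y.1.1 : ℕ) + (y.1.2 : ℕ)) y.2.2.1) *
        thetaA2Term (τ / 3) (eisensteinCoset ((y.1.1 : ℕ) - (y.1.2 : ℕ)) y.2.2.2)) := by
  obtain ⟨⟨a, b⟩, ⟨⟨m₀, n₀⟩, ⟨m₁, n₁⟩⟩, ⟨⟨m₂, n₂⟩, ⟨m₃, n₃⟩⟩⟩ := y
  simp only [thetaA2Term, eisensteinCoset, ← Complex.exp_add]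
  congr 1
  simp [e8Vector, Fin.sum_univ_eight]
  ring

/-- The product formula for absolutely convergent double series, with its summability. -/
lemma summable_norm_mul_and_tsum {X Y : Type*} {f : X → ℂ} {g : Y → ℂ}
    (hf : Summable fun x => ‖f x‖) (hg : Summable fun y => ‖g y‖) :
    (Summable fun z : X × Y => ‖f z.1 * g z.2‖) ∧
      ∑' z : X × Y, f z.1 * g z.2 = (∑' x, f x) * ∑' y, g y :=
  ⟨hf.mul_norm hg, (tsum_mul_tsum_of_summable_norm hf hg).symm⟩

lemma tsum_e8Set_eq_sum_tetracode {τ : ℂ} (hτ : 0 < τ.im) :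
    ∑' ξ : E8Set, Complex.exp ((Real.pi : ℂ) * Complex.I * τ *
        ((∑ i, (ξ : Fin 8 → ℝ) i ^ 2 : ℝ) : ℂ)) =
      ∑ c : Fin 3 × Fin 3, (thetaA2Coset τ (c.1 : ℕ) * thetaA2Coset τ (c.2 : ℕ)) *
        (thetaA2Coset τ ((c.1 : ℕ) + (c.2 : ℕ)) * thetaA2Coset τ ((c.1 : ℕ) - (c.2 : ℕ))) := by
  rw [← e8Equiv.tsum_eq]
  have hs (c : ℤ) := summable_norm_thetaA2Coset hτ c
  have hpair (c d : ℤ) := summable_norm_mul_and_tsum (hs c) (hs d)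
  have hquad (c : Fin 3 × Fin 3) := summable_norm_mul_and_tsum
    (hpair (c.1 : ℕ) (c.2 : ℕ)).1 (hpair ((c.1 : ℕ) + (c.2 : ℕ)) ((c.1 : ℕ) - (c.2 : ℕ))).1
  have hval (y : TetracodeIndex) : (e8Equiv y : Fin 8 → ℝ) = e8Vector y := rfl
  simp only [hval, exp_e8Vector]
  rw [tsum_prod_of_fintype]
  · refine Finset.sum_congr rfl fun c _ => ?_
    rw [(hquad c).2, (hpair _ _).2, (hpair _ _).2]
    simp only [thetaA2Coset]
  · exact fun c => (hquad c).1

/-- **The theta function of \`E₈\` in terms of the \`A₂\` theta function.**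
For `τ` in the upper half-plane,
`θ_{E₈}(τ) = Θ_{A₂}(τ)·((Θ_{A₂}(τ/3) − Θ_{A₂}(τ))³ + Θ_{A₂}(τ)³)`, reflecting the
decomposition of the `E₈` lattice into cosets of the `A₂ × E₆` sublattice. -/
theorem E8_theta_from_A2 (τ : ℂ) (hτ : 0 < τ.im) :
    ∑' ξ : E8Set, Complex.exp ((Real.pi : ℂ) * Complex.I * τ *
        ((∑ i, (ξ : Fin 8 → ℝ) i ^ 2 : ℝ) : ℂ)) =
      thetaA2 τ * ((thetaA2 (τ / 3) - thetaA2 τ) ^ 3 + thetaA2 τ ^ 3) := by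
  have h₃ : thetaA2Coset τ 3 = thetaA2 τ := by
    rw [← thetaA2Coset_zero, ← thetaA2Coset_add_three τ 0, zero_add]
  have hn₁ : thetaA2Coset τ (-1) = thetaA2Coset τ 1 := thetaA2Coset_neg τ 1
  have hn₂ : thetaA2Coset τ (-2) = thetaA2Coset τ 1 :=
    (thetaA2Coset_neg τ 2).trans (thetaA2Coset_two τ)
  have h₄ : thetaA2Coset τ 4 = thetaA2Coset τ 1 := thetaA2Coset_add_three τ 1
  rw [tsum_e8Set_eq_sum_tetracode hτ, thetaA2_div_three hτ, Fintype.sum_prod_type]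
  simp only [Fin.sum_univ_three, Fin.val_zero, Fin.val_one, Fin.val_two]
  norm_num [thetaA2Coset_zero, thetaA2Coset_two, h₃, h₄, hn₁, hn₂]
  ring

end
end

section
/- Let τ ∈ ℂ with Im τ > 0. Then ∑_{(m,n)∈ℤ²} exp(2πiτ(m² − mn + n²)) = ∑_{(a,b)∈ℤ²} exp(2πiτ(a² + 3b²)) + ∑_{(a,b)∈ℤ²} exp(2πiτ((a + 1/2)² + 3(b + 1/2)²)). (Equivalently, θ_{A₂}(τ) = θ₃(2τ)·θ₃(6τ) + θ₂(2τ)·θ₂(6τ) in terms of Jacobi theta constants.) -/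
noncomputable section

/-- A Gaussian series over a shift of `ℤ` converges in the upper half-plane. -/
theorem summable_exp_mul_add_sq {τ : ℂ} (hτ : 0 < τ.im) (c : ℂ) :
    Summable fun n : ℤ ↦ Complex.exp ((Real.pi : ℂ) * Complex.I * τ * ((n : ℂ) + c) ^ 2) := by
  refine (((summable_jacobiTheta₂_term_iff (c * τ) τ).2 hτ).mul_left
    (Complex.exp (Real.pi * Complex.I * τ * c ^ 2))).congr fun n ↦ ?_
  rw [jacobiTheta₂_term, ← Complex.exp_add]
  ring_nf

/-- The product of two shifted Gaussian series at `2τ` and `6τ` is the double series attached to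
the quadratic form `a² + 3b²` on the shifted lattice. -/
theorem hasSum_exp_sq_add_three_mul_sq {τ : ℂ} (hτ : 0 < τ.im) (c : ℂ) :
    HasSum (fun p : ℤ × ℤ ↦ Complex.exp (2 * (Real.pi : ℂ) * Complex.I * τ *
        (((p.1 : ℂ) + c) ^ 2 + 3 * ((p.2 : ℂ) + c) ^ 2)))
      ((∑' n : ℤ, Complex.exp ((Real.pi : ℂ) * Complex.I * (2 * τ) * ((n : ℂ) + c) ^ 2)) *
        ∑' n : ℤ, Complex.exp ((Real.pi : ℂ) * Complex.I * (6 * τ) * ((n : ℂ) + c) ^ 2)) := by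
  have h2 := (summable_exp_mul_add_sq (τ := 2 * τ) (by simpa using hτ) c).norm
  have h6 := (summable_exp_mul_add_sq (τ := 6 * τ) (by simpa using hτ) c).norm
  rw [tsum_mul_tsum_of_summable_norm h2 h6]
  refine (summable_mul_of_summable_norm h2 h6).hasSum.congr_fun fun p ↦ ?_
  rw [← Complex.exp_add]
  ring_nf

/-- The splitting of `ℤ²` according to the parity of the second coordinate, in coordinates that
diagonalise the quadratic form `m² − mn + n²`. -/
def hexagonalSplitEquiv : (ℤ × ℤ) ⊕ (ℤ × ℤ) ≃ ℤ × ℤ :=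
  Equiv.ofBijective
    (Sum.elim (fun p ↦ (p.1 + p.2, 2 * p.2)) fun p ↦ (p.1 + p.2 + 1, 2 * p.2 + 1)) <| by
    constructor
    · rintro (⟨a, b⟩ | ⟨a, b⟩) (⟨c, d⟩ | ⟨c, d⟩) h <;>
        simp only [Sum.elim_inl, Sum.elim_inr, Prod.mk.injEq, Sum.inl.injEq, Sum.inr.injEq,
          reduceCtorEq] at h ⊢ <;> omega
    · rintro ⟨m, n⟩
      obtain ⟨b, rfl | rfl⟩ := n.even_or_odd'
      · exact ⟨.inl (m - b, b), by simp⟩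
      · exact ⟨.inr (m - b - 1, b), by simp; ring⟩

theorem hexagonalSplitEquiv_inl (p : ℤ × ℤ) :
    hexagonalSplitEquiv (.inl p) = (p.1 + p.2, 2 * p.2) := rfl

theorem hexagonalSplitEquiv_inr (p : ℤ × ℤ) :
    hexagonalSplitEquiv (.inr p) = (p.1 + p.2 + 1, 2 * p.2 + 1) := rfl

/-- The double series of `thetaA2` converges to the sum of the values over the two classes of
`hexagonalSplitEquiv`. -/
theorem thetaA2_eq_add {τ a b : ℂ}
    (ha : HasSum (fun p : ℤ × ℤ ↦ Complex.exp (2 * (Real.pi : ℂ) * Complex.I * τ *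
        ((p.1 : ℂ) ^ 2 + 3 * (p.2 : ℂ) ^ 2))) a)
    (hb : HasSum (fun p : ℤ × ℤ ↦ Complex.exp (2 * (Real.pi : ℂ) * Complex.I * τ *
        (((p.1 : ℂ) + 1 / 2) ^ 2 + 3 * ((p.2 : ℂ) + 1 / 2) ^ 2))) b) :
    thetaA2 τ = a + b := by
  refine (hexagonalSplitEquiv.hasSum_iff.1 (HasSum.sum ?_ ?_)).tsum_eq
  · convert ha using 2 with p
    simp only [Function.comp_apply, hexagonalSplitEquiv_inl]
    push_cast
    ring_nf
  · convert hb using 2 with p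
    simp only [Function.comp_apply, hexagonalSplitEquiv_inr]
    push_cast
    ring_nf

/-- **Splitting of the \`A₂\` theta function.**
For `τ` in the upper half-plane,
`∑_{(m,n)∈ℤ²} exp(2πiτ(m² − mn + n²))
  = ∑_{(a,b)∈ℤ²} exp(2πiτ(a² + 3b²)) + ∑_{(a,b)∈ℤ²} exp(2πiτ((a+1/2)² + 3(b+1/2)²))`;
equivalently, `θ_{A₂}(τ) = θ₃(2τ)·θ₃(6τ) + θ₂(2τ)·θ₂(6τ)`. -/
theorem thetaA2_split (τ : ℂ) (hτ : 0 < τ.im) :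
    thetaA2 τ =
      (∑' p : ℤ × ℤ, Complex.exp (2 * (Real.pi : ℂ) * Complex.I * τ *
        ((p.1 : ℂ) ^ 2 + 3 * (p.2 : ℂ) ^ 2))) +
      (∑' p : ℤ × ℤ, Complex.exp (2 * (Real.pi : ℂ) * Complex.I * τ *
        (((p.1 : ℂ) + 1 / 2) ^ 2 + 3 * ((p.2 : ℂ) + 1 / 2) ^ 2))) ∧
    thetaA2 τ = jacobiTheta3 (2 * τ) * jacobiTheta3 (6 * τ) +
      jacobiTheta2 (2 * τ) * jacobiTheta2 (6 * τ) := by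
  have h0 := hasSum_exp_sq_add_three_mul_sq hτ 0
  simp only [add_zero] at h0
  have h1 := hasSum_exp_sq_add_three_mul_sq hτ (1 / 2)
  exact ⟨thetaA2_eq_add h0.summable.hasSum h1.summable.hasSum, thetaA2_eq_add h0 h1⟩

end
end

section
/- Let τ ∈ ℂ with Im τ > 0. Then ∑_{(m,n)∈ℤ²} (−1)^m · exp(2πiτ(m² − mn + n²)) = ∑_{(a,b)∈ℤ²} exp(2πiτ(a² + 3b²)) − ∑_{(a,b)∈ℤ²} exp(2πiτ((a + 1/2)² + 3(b + 1/2)²)). (Equivalently, θ_{A₂,inner}(τ) = θ₃(2τ)·θ₃(6τ) − θ₂(2τ)·θ₂(6τ).) -/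
noncomputable section

/-- The twisted theta function of the `A₂` root lattice, with the weight `(−1)^m`
of the order-2 inner automorphism inserted:
`θ_{A₂,inner}(τ) = ∑_{(m,n)∈ℤ²} (−1)^m exp(2πiτ(m² − mn + n²))`. -/
def thetaA2Inner (τ : ℂ) : ℂ :=
  ∑' p : ℤ × ℤ, (-1 : ℂ) ^ p.1 * Complex.exp (2 * (Real.pi : ℂ) * Complex.I * τ *
    ((p.1 : ℂ) ^ 2 - (p.1 : ℂ) * (p.2 : ℂ) + (p.2 : ℂ) ^ 2))

lemma summable_exp_mul_add_half_sq {τ : ℂ} (hτ : 0 < τ.im) :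
    Summable fun n : ℤ ↦
      Complex.exp ((Real.pi : ℂ) * Complex.I * τ * ((n : ℂ) + 1 / 2) ^ 2) := by
  refine (((summable_jacobiTheta₂_term_iff (τ / 2) τ).mpr hτ).mul_left
    (Complex.exp ((Real.pi : ℂ) * Complex.I * τ / 4))).congr fun n ↦ ?_
  rw [jacobiTheta₂_term, ← Complex.exp_add]
  ring_nf

lemma summable_exp_mul_sq {τ : ℂ} (hτ : 0 < τ.im) :
    Summable fun n : ℤ ↦ Complex.exp ((Real.pi : ℂ) * Complex.I * τ * (n : ℂ) ^ 2) := by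
  refine ((summable_jacobiTheta₂_term_iff 0 τ).mpr hτ).congr fun n ↦ ?_
  rw [jacobiTheta₂_term]
  ring_nf

lemma hasSum_theta3_mul_theta3 {τ : ℂ} (hτ : 0 < τ.im) :
    HasSum (fun p : ℤ × ℤ ↦ Complex.exp (2 * (Real.pi : ℂ) * Complex.I * τ *
      ((p.1 : ℂ) ^ 2 + 3 * (p.2 : ℂ) ^ 2)))
      (jacobiTheta3 (2 * τ) * jacobiTheta3 (6 * τ)) := by
  have h₁ := (summable_exp_mul_sq (τ := 2 * τ) (by simpa using hτ)).norm
  have h₂ := (summable_exp_mul_sq (τ := 6 * τ) (by simpa using hτ)).norm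
  rw [jacobiTheta3, jacobiTheta3, tsum_mul_tsum_of_summable_norm h₁ h₂]
  refine (summable_mul_of_summable_norm h₁ h₂).hasSum.congr_fun fun p ↦ ?_
  rw [← Complex.exp_add]
  ring_nf

lemma hasSum_theta2_mul_theta2 {τ : ℂ} (hτ : 0 < τ.im) :
    HasSum (fun p : ℤ × ℤ ↦ Complex.exp (2 * (Real.pi : ℂ) * Complex.I * τ *
      (((p.1 : ℂ) + 1 / 2) ^ 2 + 3 * ((p.2 : ℂ) + 1 / 2) ^ 2)))
      (jacobiTheta2 (2 * τ) * jacobiTheta2 (6 * τ)) := by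
  have h₁ := (summable_exp_mul_add_half_sq (τ := 2 * τ) (by simpa using hτ)).norm
  have h₂ := (summable_exp_mul_add_half_sq (τ := 6 * τ) (by simpa using hτ)).norm
  rw [jacobiTheta2, jacobiTheta2, tsum_mul_tsum_of_summable_norm h₁ h₂]
  refine (summable_mul_of_summable_norm h₁ h₂).hasSum.congr_fun fun p ↦ ?_
  rw [← Complex.exp_add]
  ring_nf

/-- A sum over `ℤ × ℤ` splits according to the parity of the first coordinate, each half being
reparametrized by coordinates that diagonalize `m² - mn + n²`. -/
lemma hasSum_of_even_add_odd_fst {f : ℤ × ℤ → ℂ} {x y : ℂ}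
    (hx : HasSum (fun p : ℤ × ℤ ↦ f (2 * p.2, p.1 + p.2)) x)
    (hy : HasSum (fun p : ℤ × ℤ ↦ f (2 * p.2 + 1, p.1 + p.2 + 1)) y) :
    HasSum f (x + y) := by
  have he : Function.Injective fun p : ℤ × ℤ ↦ (2 * p.2, p.1 + p.2) := by
    rintro ⟨a, b⟩ ⟨c, d⟩ h
    simp only [Prod.mk.injEq] at h ⊢
    omega
  have ho : Function.Injective fun p : ℤ × ℤ ↦ (2 * p.2 + 1, p.1 + p.2 + 1) := by
    rintro ⟨a, b⟩ ⟨c, d⟩ h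
    simp only [Prod.mk.injEq] at h ⊢
    omega
  refine HasSum.add_isCompl ⟨?_, codisjoint_iff.mpr ?_⟩
    (he.hasSum_range_iff.mpr hx) (ho.hasSum_range_iff.mpr hy)
  · rw [Set.disjoint_left]
    rintro _ ⟨⟨a, b⟩, rfl⟩ ⟨⟨c, d⟩, h⟩
    simp only [Prod.mk.injEq] at h
    omega
  · refine Set.eq_univ_of_forall fun ⟨m, n⟩ ↦ ?_
    obtain ⟨k, hk⟩ | ⟨k, hk⟩ := m.even_or_odd
    · exact Or.inl ⟨(n - k, k), by ext <;> simp only <;> omega⟩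
    · exact Or.inr ⟨(n - k - 1, k), by ext <;> simp only <;> omega⟩

/-- **Splitting of the twisted \`A₂\` theta function.**
For `τ` in the upper half-plane,
`∑_{(m,n)∈ℤ²} (−1)^m exp(2πiτ(m² − mn + n²))
  = ∑_{(a,b)∈ℤ²} exp(2πiτ(a² + 3b²)) − ∑_{(a,b)∈ℤ²} exp(2πiτ((a+1/2)² + 3(b+1/2)²))`;
equivalently, `θ_{A₂,inner}(τ) = θ₃(2τ)·θ₃(6τ) − θ₂(2τ)·θ₂(6τ)`. -/
theorem thetaA2Inner_split (τ : ℂ) (hτ : 0 < τ.im) :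
    thetaA2Inner τ =
      (∑' p : ℤ × ℤ, Complex.exp (2 * (Real.pi : ℂ) * Complex.I * τ *
        ((p.1 : ℂ) ^ 2 + 3 * (p.2 : ℂ) ^ 2))) -
      (∑' p : ℤ × ℤ, Complex.exp (2 * (Real.pi : ℂ) * Complex.I * τ *
        (((p.1 : ℂ) + 1 / 2) ^ 2 + 3 * ((p.2 : ℂ) + 1 / 2) ^ 2))) ∧
    thetaA2Inner τ = jacobiTheta3 (2 * τ) * jacobiTheta3 (6 * τ) -
      jacobiTheta2 (2 * τ) * jacobiTheta2 (6 * τ) := by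
  have h3 := hasSum_theta3_mul_theta3 hτ
  have h2 := hasSum_theta2_mul_theta2 hτ
  have h : thetaA2Inner τ = jacobiTheta3 (2 * τ) * jacobiTheta3 (6 * τ) -
      jacobiTheta2 (2 * τ) * jacobiTheta2 (6 * τ) := by
    rw [sub_eq_add_neg]
    refine (hasSum_of_even_add_odd_fst ?_ ?_).tsum_eq
    · refine h3.congr_fun fun p ↦ ?_
      rw [(even_two_mul p.2).neg_one_zpow, one_mul]
      push_cast
      ring_nf
    · refine h2.neg.congr_fun fun p ↦ ?_
      rw [(odd_two_mul_add_one p.2).neg_one_zpow, neg_one_mul]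
      push_cast
      ring_nf
  exact ⟨by rw [h, h3.tsum_eq, h2.tsum_eq], h⟩

end
end

section
/- Let τ ∈ ℂ with Im τ > 0 and let i be an integer with 0 ≤ i ≤ 7. Then 2·∑_{α ∈ ℤ⁷, ∑ⱼαⱼ ∈ 2ℤ} (−1)^{α₁ + ⋯ + α_i} · exp(πiτ·∑ⱼ αⱼ²) = θ₃(τ)^i·θ₄(τ)^{7−i} + θ₃(τ)^{7−i}·θ₄(τ)^i. -/
noncomputable section

/-- The `D₇` lattice: integer vectors `α ∈ ℤ⁷` with even coordinate sum. -/
def D7Set : Set (Fin 7 → ℤ) := {α | ∃ k : ℤ, ∑ j, α j = 2 * k}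

/-- A finite product of absolutely convergent sums is the absolutely convergent sum, over tuples of
indices, of the products of the terms. -/
theorem summable_norm_and_tsum_pi_prod {β : Type*} {n : ℕ} (f : Fin n → β → ℂ)
    (hf : ∀ j, Summable fun b => ‖f j b‖) :
    (Summable fun α : Fin n → β => ‖∏ j, f j (α j)‖) ∧
      ∑' α : Fin n → β, ∏ j, f j (α j) = ∏ j, ∑' b, f j b := by
  induction n with
  | zero => simp [Summable.of_finite]
  | succ n ih =>
    obtain ⟨hsum, htsum⟩ := ih (fun j => f j.succ) fun j => hf j.succ
    have hprod (p : β × (Fin n → β)) :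
        ∏ j, f j (Fin.consEquiv (fun _ => β) p j) = f 0 p.1 * ∏ j : Fin n, f j.succ (p.2 j) := by
      simp [Fin.consEquiv, Fin.prod_univ_succ]
    constructor
    · rw [← (Fin.consEquiv fun _ => β).summable_iff]
      simpa only [Function.comp_def, hprod] using (hf 0).mul_norm hsum
    · rw [← (Fin.consEquiv fun _ => β).tsum_eq]
      simp only [hprod]
      rw [Fin.prod_univ_succ, ← htsum, tsum_mul_tsum_of_summable_norm (hf 0) hsum]

theorem summable_norm_exp_pi_mul_sq {τ : ℂ} (hτ : 0 < τ.im) :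
    Summable fun n : ℤ => ‖Complex.exp ((Real.pi : ℂ) * Complex.I * τ * (n : ℂ) ^ 2)‖ := by
  refine ((summable_jacobiTheta₂_term_iff 0 τ).2 hτ).norm.congr fun n => ?_
  rw [jacobiTheta₂_term]
  congr 2
  ring

theorem neg_one_zpow_sum {ι : Type*} (s : Finset ι) (α : ι → ℤ) :
    (-1 : ℂ) ^ (∑ j ∈ s, α j) = ∏ j ∈ s, (-1 : ℂ) ^ α j := by
  classical
  induction s using Finset.induction_on with
  | empty => simp
  | insert a s ha ih => rw [Finset.sum_insert ha, Finset.prod_insert ha, zpow_add₀ (by simp), ih]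

/-- The theta series of `ℤⁿ` with sign character `(-1) ^ ∑ j ∈ s, α j` factors into
one-dimensional theta constants. -/
theorem summable_and_tsum_signed_theta {τ : ℂ} (hτ : 0 < τ.im) {n : ℕ} (s : Finset (Fin n)) :
    (Summable fun α : Fin n → ℤ => (-1 : ℂ) ^ (∑ j ∈ s, α j) *
        Complex.exp ((Real.pi : ℂ) * Complex.I * τ * ∑ j, (α j : ℂ) ^ 2)) ∧
      ∑' α : Fin n → ℤ, (-1 : ℂ) ^ (∑ j ∈ s, α j) *
        Complex.exp ((Real.pi : ℂ) * Complex.I * τ * ∑ j, (α j : ℂ) ^ 2) =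
          jacobiTheta4 τ ^ s.card * jacobiTheta3 τ ^ (n - s.card) := by
  let f (j : Fin n) (m : ℤ) : ℂ := (if j ∈ s then (-1 : ℂ) ^ m else 1) *
    Complex.exp ((Real.pi : ℂ) * Complex.I * τ * (m : ℂ) ^ 2)
  have hf (j : Fin n) : Summable fun m => ‖f j m‖ := by
    refine (summable_norm_exp_pi_mul_sq hτ).congr fun m => ?_
    by_cases hj : j ∈ s <;> simp [f, hj]
  have hterm (α : Fin n → ℤ) : ∏ j, f j (α j) = (-1 : ℂ) ^ (∑ j ∈ s, α j) *
      Complex.exp ((Real.pi : ℂ) * Complex.I * τ * ∑ j, (α j : ℂ) ^ 2) := by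
    simp only [f]
    rw [Finset.prod_mul_distrib, Finset.prod_ite_mem, Finset.univ_inter, neg_one_zpow_sum,
      Finset.mul_sum, Complex.exp_sum]
  obtain ⟨hsum, htsum⟩ := summable_norm_and_tsum_pi_prod f hf
  simp only [← hterm]
  refine ⟨hsum.of_norm, htsum.trans ?_⟩
  have hfactor (j : Fin n) :
      ∑' m, f j m = if j ∈ s then jacobiTheta4 τ else jacobiTheta3 τ := by
    by_cases hj : j ∈ s <;> simp [f, hj, jacobiTheta3, jacobiTheta4]
  simp only [hfactor]
  rw [Finset.prod_ite]
  simp [← Finset.compl_filter, Finset.card_compl]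

/-- **Twisted theta functions of \`D₇\` and the \`ℤ₂\` duality defects.**
For `τ` in the upper half-plane and `0 ≤ i ≤ 7`,
`2·∑_{α ∈ D₇} (−1)^{α₁+⋯+α_i} exp(πiτ ∑ⱼ αⱼ²)
  = θ₃(τ)^i θ₄(τ)^{7−i} + θ₃(τ)^{7−i} θ₄(τ)^i`. -/
theorem D7_twisted_theta (τ : ℂ) (hτ : 0 < τ.im) (i : ℕ) (hi : i ≤ 7) :
    2 * ∑' α : D7Set,
        ((-1 : ℂ) ^ (∑ j ∈ Finset.univ.filter (fun j : Fin 7 => (j : ℕ) < i),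
            (α : Fin 7 → ℤ) j)) *
          Complex.exp ((Real.pi : ℂ) * Complex.I * τ *
            ∑ j, ((α : Fin 7 → ℤ) j : ℂ) ^ 2) =
      jacobiTheta3 τ ^ i * jacobiTheta4 τ ^ (7 - i) +
        jacobiTheta3 τ ^ (7 - i) * jacobiTheta4 τ ^ i := by
  set s : Finset (Fin 7) := Finset.univ.filter fun j : Fin 7 => (j : ℕ) < i with hs
  have hcard : s.card = i := by simp [hs, Fin.card_filter_val_lt, hi]
  have hcard_compl : sᶜ.card = 7 - i := by simp [Finset.card_compl, hcard]
  obtain ⟨hsum, htsum⟩ := summable_and_tsum_signed_theta hτ s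
  obtain ⟨hsum_compl, htsum_compl⟩ := summable_and_tsum_signed_theta hτ sᶜ
  rw [hcard] at htsum
  rw [hcard_compl, Nat.sub_sub_self hi] at htsum_compl
  rw [tsum_subtype D7Set fun α : Fin 7 → ℤ => (-1 : ℂ) ^ (∑ j ∈ s, α j) *
    Complex.exp ((Real.pi : ℂ) * Complex.I * τ * ∑ j, (α j : ℂ) ^ 2), ← tsum_mul_left]
  rw [mul_comm (jacobiTheta3 τ ^ i), mul_comm (jacobiTheta3 τ ^ (7 - i)), ← htsum, ← htsum_compl,
    ← hsum_compl.tsum_add hsum]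
  refine tsum_congr fun α => ?_
  have hsplit : ∑ j ∈ s, α j + ∑ j ∈ sᶜ, α j = ∑ j, α j := Finset.sum_add_sum_compl s α
  by_cases hα : α ∈ D7Set
  · obtain ⟨k, hk⟩ := id hα
    have hsign : (-1 : ℂ) ^ (∑ j ∈ sᶜ, α j) = (-1 : ℂ) ^ (∑ j ∈ s, α j) := by
      rw [show ∑ j ∈ sᶜ, α j = 2 * (k - ∑ j ∈ s, α j) + ∑ j ∈ s, α j by lia,
        zpow_add₀ (by simp), zpow_mul]
      simp
    rw [Set.indicator_of_mem hα, hsign]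
    ring
  · obtain ⟨k, hk⟩ : Odd (∑ j, α j) := by
      rw [← Int.not_even_iff_odd, even_iff_exists_two_mul]
      exact hα
    have hsign : (-1 : ℂ) ^ (∑ j ∈ sᶜ, α j) = -(-1 : ℂ) ^ (∑ j ∈ s, α j) := by
      rw [show ∑ j ∈ sᶜ, α j = 2 * (k - ∑ j ∈ s, α j) + 1 + ∑ j ∈ s, α j by lia,
        zpow_add₀ (by simp), zpow_add₀ (by simp), zpow_mul]
      simp
    rw [Set.indicator_of_notMem hα, hsign]
    ring

end
end
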